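/- arXiv:1505.02299 — 2 statements merged into one kernel-verified Lean document; each statement's English description precedes it below -/
import Mathlib

section
/- The map ψ sending each vertex (a, b_2, b_3, …, b_k) of B(k,m,n) to (a, 2^a − 1 − (b_2 + b_3 + … + b_k), b_3, …, b_k) is a graph automorphism of B(k,m,n) of order 2. -/
/-- The Bouwer relation: `(a,b)` is related to `(a+1,c)` when `c = b` or `c`
differs from `b` in exactly one coordinate `j`, where `c j = b j + 2 ^ a`
(the power of `2` computed in `ZMod n`). -/
def bouwerRel (k m n : ℕ) (u v : ZMod m × (Fin (k - 1) → ZMod n)) : Prop :=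
  v.1 = u.1 + 1 ∧
    (v.2 = u.2 ∨ ∃ j : Fin (k - 1),
      (∀ i : Fin (k - 1), i ≠ j → v.2 i = u.2 i) ∧ v.2 j = u.2 j + 2 ^ (u.1).val)

/-- The Bouwer graph `B(k,m,n)`, with vertex set `ZMod m × (ZMod n)^(k-1)`. -/
def bouwer (k m n : ℕ) : SimpleGraph (ZMod m × (Fin (k - 1) → ZMod n)) :=
  SimpleGraph.fromRel (bouwerRel k m n)

/-- Replace the coordinate `i₀` of `b` by `2 ^ a - 1 - ∑ j, b j`, keeping `a` fixed. -/
def reflectCoord {m n r : ℕ} (i₀ : Fin r) (u : ZMod m × (Fin r → ZMod n)) :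
    ZMod m × (Fin r → ZMod n) :=
  (u.1, fun i => if i = i₀ then 2 ^ u.1.val - 1 - ∑ j, u.2 j else u.2 i)

lemma sum_eq_sum_add_of_eq_off {ι M : Type*} [Fintype ι] [DecidableEq ι] [AddCommGroup M]
    {b c : ι → M} {x : M} (j : ι) (h : ∀ i, i ≠ j → c i = b i) (hj : c j = b j + x) :
    ∑ i, c i = ∑ i, b i + x := by
  rw [← Finset.add_sum_erase _ c (Finset.mem_univ j),
    ← Finset.add_sum_erase _ b (Finset.mem_univ j), hj,
    Finset.sum_congr rfl fun i hi => h i (Finset.ne_of_mem_erase hi)]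
  abel

lemma reflectCoord_involutive {m n r : ℕ} (i₀ : Fin r) :
    Function.Involutive (reflectCoord (m := m) (n := n) i₀) := by
  rintro ⟨a, b⟩
  have hsum : ∑ i, (reflectCoord i₀ (a, b)).2 i
      = ∑ i, b i + (2 ^ a.val - 1 - ∑ j, b j - b i₀) :=
    sum_eq_sum_add_of_eq_off i₀ (fun i hi => by simp [reflectCoord, hi])
      (by simp [reflectCoord])
  refine Prod.ext rfl (funext fun i => ?_)
  by_cases hi : i = i₀
  · subst hi
    change (if i = i then 2 ^ a.val - 1 - ∑ j, (reflectCoord i (a, b)).2 j else _) = b i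
    rw [if_pos rfl, hsum]
    ring
  · simp [reflectCoord, hi]

lemma ZMod.pow_val_add_one {M : Type*} [Monoid M] {m : ℕ} (hm : 1 < m) {x : M}
    (hx : x ^ m = 1) (a : ZMod m) : x ^ (a + 1).val = x ^ a.val * x := by
  have : Fact (1 < m) := ⟨hm⟩
  have : NeZero m := ⟨by omega⟩
  rw [ZMod.val_add, ZMod.val_one, ← pow_eq_pow_mod _ hx, pow_succ]

lemma bouwerRel_reflectCoord {k m n : ℕ} (hm : 1 < m) (h2 : (2 : ZMod n) ^ m = 1)
    (i₀ : Fin (k - 1)) {u v : ZMod m × (Fin (k - 1) → ZMod n)} (h : bouwerRel k m n u v) :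
    bouwerRel k m n (reflectCoord i₀ u) (reflectCoord i₀ v) := by
  obtain ⟨a, b⟩ := u
  obtain ⟨a', c⟩ := v
  obtain ⟨rfl : a' = a + 1, h⟩ := h
  have hpow := ZMod.pow_val_add_one hm h2 a
  refine ⟨rfl, ?_⟩
  rcases h with rfl | ⟨j, hne, hj⟩
  · refine Or.inr ⟨i₀, fun i hi => by simp [reflectCoord, hi], ?_⟩
    simp only [reflectCoord, if_true, hpow]
    ring
  · have hsum := sum_eq_sum_add_of_eq_off j hne hj
    have hi₀ : (reflectCoord i₀ (a + 1, c)).2 i₀ = (reflectCoord i₀ (a, b)).2 i₀ := by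
      simp only [reflectCoord, if_true, hpow]
      linear_combination -hsum
    by_cases hj₀ : j = i₀
    · subst hj₀
      refine Or.inl (funext fun i => ?_)
      by_cases hi : i = j
      · rw [hi, hi₀]
      · simpa [reflectCoord, hi] using hne i hi
    · refine Or.inr ⟨j, fun i hi => ?_, by simpa [reflectCoord, hj₀] using hj⟩
      by_cases hi' : i = i₀
      · rw [hi', hi₀]
      · simpa [reflectCoord, hi'] using hne i hi

lemma bouwer_adj_reflectCoord {k m n : ℕ} (hm : 1 < m) (h2 : (2 : ZMod n) ^ m = 1)
    (i₀ : Fin (k - 1)) {u v : ZMod m × (Fin (k - 1) → ZMod n)} (h : (bouwer k m n).Adj u v) :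
    (bouwer k m n).Adj (reflectCoord i₀ u) (reflectCoord i₀ v) := by
  rw [bouwer, SimpleGraph.fromRel_adj] at h ⊢
  exact ⟨(reflectCoord_involutive i₀).injective.ne h.1,
    h.2.imp (bouwerRel_reflectCoord hm h2 i₀) (bouwerRel_reflectCoord hm h2 i₀)⟩

lemma reflectCoord_ne_id {m n r : ℕ} (hm : 1 < m) (hn : 1 < n) (i₀ : Fin r) :
    reflectCoord (m := m) (n := n) i₀ ≠ id := by
  have : Fact (1 < m) := ⟨hm⟩
  have : Fact (1 < n) := ⟨hn⟩
  intro h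
  have h₀ := congrFun (congrArg Prod.snd (congrFun h (1, 0))) i₀
  simp only [reflectCoord, if_true, ZMod.val_one, Pi.zero_apply, Finset.sum_const_zero, id,
    pow_one, sub_zero] at h₀
  exact one_ne_zero (α := ZMod n) (by linear_combination h₀)


/-- The map `ψ` sending each vertex `(a, b₂, b₃, …, b_k)` of `B(k,m,n)` to
`(a, 2^a - 1 - (b₂ + b₃ + ⋯ + b_k), b₃, …, b_k)` is a graph automorphism of
`B(k,m,n)` of order `2`. -/
theorem bouwer_psi (k m n : ℕ) (hk : 1 < k) (hm : 1 < m) (hn : 1 < n)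
    (h2 : (2 : ZMod n) ^ m = 1) :
    ∃ ψ : Equiv.Perm (ZMod m × (Fin (k - 1) → ZMod n)),
      (∀ u v, (bouwer k m n).Adj u v ↔ (bouwer k m n).Adj (ψ u) (ψ v)) ∧
      (∀ (a : ZMod m) (b : Fin (k - 1) → ZMod n),
        ψ (a, b) = (a, fun i => if i = (⟨0, by omega⟩ : Fin (k - 1)) then
          2 ^ a.val - 1 - (∑ j, b j) else b i)) ∧
      orderOf ψ = 2 := by
  set i₀ : Fin (k - 1) := ⟨0, by omega⟩
  have hinv : Function.Involutive (reflectCoord (m := m) (n := n) i₀) :=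
    reflectCoord_involutive i₀
  refine ⟨hinv.toPerm, fun u v => ⟨bouwer_adj_reflectCoord hm h2 i₀, fun h => ?_⟩,
    fun a b => rfl, orderOf_eq_prime ?_ fun h => ?_⟩
  · simpa only [Function.Involutive.coe_toPerm, hinv u, hinv v]
      using bouwer_adj_reflectCoord hm h2 i₀ h
  · rw [pow_two]
    exact Equiv.ext hinv
  · exact reflectCoord_ne_id hm hn i₀ (congrArg DFunLike.coe h)
end

section
/- Assume m > 6 and n > 7. In B(k,m,n), the 2-arc (0,0) – (1,0) – (2,0) lies in no 6-cycle, each 2-arc of the form (0,0) – (1,0) – (2, 2e_r) lies in exactly one 6-cycle, and each 2-arc of the form (0,0) – (1,0) – (0, −e_r) lies in exactly k different 6-cycles. -/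
/-- The `r`-th standard basis vector of `(ZMod n)^(k-1)`. -/
def stdBasis (k n : ℕ) (r : Fin (k - 1)) : Fin (k - 1) → ZMod n :=
  fun i => if i = r then 1 else 0

/-- The number of 6-cycles of `G` containing the 2-arc `v₀ – v₁ – v₂`: each such
(undirected) 6-cycle corresponds to exactly one closed walk of length 6 based at
`v₀` whose first three vertices are `v₀, v₁, v₂`. -/
noncomputable def numSixCyclesThru {V : Type*} (G : SimpleGraph V) (v₀ v₁ v₂ : V) : ℕ :=
  Set.ncard {c : G.Walk v₀ v₀ | c.IsCycle ∧ c.length = 6 ∧ c.support.take 3 = [v₀, v₁, v₂]}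


section Walks

variable {V : Type*}

/-- The last three vertices of the 6-cycles through a given 2-arc. -/
def sixCycleTails (G : SimpleGraph V) (v₀ v₁ v₂ : V) : Set (V × V × V) :=
  {t | G.Adj v₂ t.1 ∧ G.Adj t.1 t.2.1 ∧ G.Adj t.2.1 t.2.2 ∧ G.Adj t.2.2 v₀ ∧
    [v₀, v₁, v₂, t.1, t.2.1, t.2.2].Nodup}

lemma exists_vertices_of_sixCycle {G : SimpleGraph V} {v₀ v₁ v₂ : V} {c : G.Walk v₀ v₀}
    (hc : c.IsCycle) (hl : c.length = 6) (hs : c.support.take 3 = [v₀, v₁, v₂]) :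
    ∃ t ∈ sixCycleTails G v₀ v₁ v₂, c.support = [v₀, v₁, v₂, t.1, t.2.1, t.2.2, v₀] ∧
      (c.getVert 3, c.getVert 4, c.getVert 5) = t := by
  have hnd := hc.support_nodup
  match c, hl with
  | .cons h₁ (.cons h₂ (.cons (v := x) h₃ (.cons (v := y) h₄ (.cons (v := z) h₅ (.cons h₆ .nil))))), _ =>
    simp only [SimpleGraph.Walk.support_cons, SimpleGraph.Walk.support_nil, List.take,
      List.cons.injEq, and_true, true_and] at hs
    obtain ⟨rfl, rfl⟩ := hs
    refine ⟨(x, y, z), ⟨h₃, h₄, h₅, h₆, ?_⟩, by simp, by simp⟩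
    simp only [SimpleGraph.Walk.support_cons, SimpleGraph.Walk.support_nil, List.tail_cons] at hnd
    exact (List.perm_append_comm (l₁ := [v₀]) (l₂ := [_, _, _, _, _])).nodup_iff.mpr hnd

lemma exists_sixCycle_of_mem_tails {G : SimpleGraph V} {v₀ v₁ v₂ : V} (h₁ : G.Adj v₀ v₁)
    (h₂ : G.Adj v₁ v₂) {t : V × V × V} (ht : t ∈ sixCycleTails G v₀ v₁ v₂) :
    ∃ c : G.Walk v₀ v₀, (c.IsCycle ∧ c.length = 6 ∧ c.support.take 3 = [v₀, v₁, v₂]) ∧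
      (c.getVert 3, c.getVert 4, c.getVert 5) = t := by
  obtain ⟨x, y, z⟩ := t
  obtain ⟨h₃, h₄, h₅, h₆, hnd⟩ := ht
  refine ⟨.cons h₁ (.cons h₂ (.cons h₃ (.cons h₄ (.cons h₅ (.cons h₆ .nil))))), ⟨?_, rfl, rfl⟩, rfl⟩
  rw [SimpleGraph.Walk.cons_isCycle_iff]
  simp only [List.nodup_cons, List.mem_cons, not_or, List.not_mem_nil, not_false_eq_true,
    List.nodup_nil, and_true] at hnd
  obtain ⟨⟨n₁, n₂, n₃, n₄, n₅⟩, ⟨n₆, n₇, n₈, n₉⟩, ⟨n₁₀, n₁₁, n₁₂⟩, ⟨n₁₃, n₁₄⟩, n₁₅⟩ := hnd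
  constructor
  · rw [SimpleGraph.Walk.isPath_def]
    simp [*, Ne.symm]
  · simp
    grind

lemma numSixCyclesThru_eq_ncard_tails {G : SimpleGraph V} {v₀ v₁ v₂ : V} (h₁ : G.Adj v₀ v₁)
    (h₂ : G.Adj v₁ v₂) :
    numSixCyclesThru G v₀ v₁ v₂ = (sixCycleTails G v₀ v₁ v₂).ncard := by
  refine Set.ncard_congr (fun c _ => (c.getVert 3, c.getVert 4, c.getVert 5)) ?_ ?_ ?_
  · rintro c ⟨hc, hl, hs⟩
    obtain ⟨t, ht, -, rfl⟩ := exists_vertices_of_sixCycle hc hl hs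
    exact ht
  · rintro c d ⟨hc, hl, hs⟩ ⟨hc', hl', hs'⟩ h
    obtain ⟨t, -, hct, rfl⟩ := exists_vertices_of_sixCycle hc hl hs
    obtain ⟨t', -, hdt, rfl⟩ := exists_vertices_of_sixCycle hc' hl' hs'
    apply SimpleGraph.Walk.ext_support
    rw [hct, hdt, h]
  · intro t ht
    obtain ⟨c, hc, rfl⟩ := exists_sixCycle_of_mem_tails h₁ h₂ ht
    exact ⟨c, hc, rfl⟩

end Walks

section Bouwer

variable {k m n : ℕ}

/-- The power of `2` attached to the level `p`, taken modulo `m`. -/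
def levelWeight (m n : ℕ) (p : ℤ) : ZMod n := 2 ^ (p : ZMod m).val

/-- The vertex of the Bouwer graph with integer level `p` and vector `f`. -/
def vtx (m : ℕ) {k n : ℕ} (p : ℤ) (f : Fin (k - 1) → ZMod n) :
    ZMod m × (Fin (k - 1) → ZMod n) := (p, f)

/-- The `i`-th coordinate of the vector labelled by `l`: the zero vector for `none` and the
basis vector `e_j` for `some j`. -/
def label (l : Option (Fin (k - 1))) (i : Fin (k - 1)) : ℤ := if l = some i then 1 else 0

/-- The vector over `ZMod n` labelled by `l`. -/
def labelVec (n : ℕ) (l : Option (Fin (k - 1))) (i : Fin (k - 1)) : ZMod n := (label l i : ℤ)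

lemma label_nonneg (l : Option (Fin (k - 1))) (i : Fin (k - 1)) : 0 ≤ label l i := by
  unfold label; split_ifs <;> simp

lemma label_le_one (l : Option (Fin (k - 1))) (i : Fin (k - 1)) : label l i ≤ 1 := by
  unfold label; split_ifs <;> simp

@[simp] lemma label_none (i : Fin (k - 1)) : label none i = 0 := by simp [label]

@[simp] lemma label_some_self (i : Fin (k - 1)) : label (some i) i = 1 := by simp [label]

lemma eq_some_of_label {l : Option (Fin (k - 1))} {i : Fin (k - 1)} (h : label l i = 1) :
    l = some i := by
  unfold label at h; split_ifs at h with h'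
  · exact h'
  · simp at h

lemma eq_none_of_label {l : Option (Fin (k - 1))} (h : ∀ i, label l i = 0) : l = none := by
  cases l with
  | none => rfl
  | some j => simpa using h j

lemma exists_label_ne {a b : Option (Fin (k - 1))} (h : a ≠ b) : ∃ i, label a i ≠ label b i := by
  by_contra! H
  apply h
  cases a with
  | none => exact (eq_none_of_label fun i => by simp [← H i]).symm
  | some j => exact (eq_some_of_label (by simp [← H j])).symm

lemma levelWeight_zero (hm : 6 < m) : levelWeight m n 0 = 1 := by
  have : NeZero m := ⟨by omega⟩
  simp [levelWeight]

lemma levelWeight_add_one (hm : 6 < m) (h2 : (2 : ZMod n) ^ m = 1) (p : ℤ) :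
    levelWeight m n (p + 1) = 2 * levelWeight m n p := by
  have : NeZero m := ⟨by omega⟩
  have : Fact (1 < m) := ⟨by omega⟩
  have key : ∀ x : ℕ, (2 : ZMod n) ^ (x % m) = 2 ^ x := fun x => by
    conv_rhs => rw [← Nat.div_add_mod x m, pow_add, pow_mul, h2, one_pow, one_mul]
  simp only [levelWeight, Int.cast_add, Int.cast_one]
  rw [ZMod.val_add, ZMod.val_one, key, pow_succ']

lemma int_eq_zero_of_cast {N : ℕ} {z : ℤ} (h : (z : ZMod N) = 0) (hz : |z| < N) : z = 0 := by
  rw [ZMod.intCast_zmod_eq_zero_iff_dvd] at h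
  exact Int.eq_zero_of_abs_lt_dvd h hz

lemma bouwerRel_iff (u v : ZMod m × (Fin (k - 1) → ZMod n)) :
    bouwerRel k m n u v ↔
      ∃ l, v = (u.1 + 1, fun i => u.2 i + 2 ^ u.1.val * labelVec n l i) := by
  obtain ⟨a, f⟩ := u
  obtain ⟨b, g⟩ := v
  simp only [bouwerRel, Prod.mk.injEq, labelVec, label]
  constructor
  · rintro ⟨rfl, rfl | ⟨j, h, hj⟩⟩
    · exact ⟨none, rfl, by simp⟩
    · refine ⟨some j, rfl, funext fun i => ?_⟩
      by_cases hi : i = j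
      · subst hi; simp [hj]
      · simp [h i hi, Ne.symm hi]
  · rintro ⟨l | j, rfl, rfl⟩
    · exact ⟨rfl, Or.inl (by simp)⟩
    · exact ⟨rfl, Or.inr ⟨j, fun i hi => by simp [Ne.symm hi], by simp⟩⟩

lemma bouwer_adj_vtx_iff (hm : 6 < m) (p : ℤ) (f : Fin (k - 1) → ZMod n)
    (v : ZMod m × (Fin (k - 1) → ZMod n)) :
    (bouwer k m n).Adj (vtx m p f) v ↔
      (∃ l, v = vtx m (p + 1) fun i => f i + levelWeight m n p * labelVec n l i) ∨
      ∃ l, v = vtx m (p - 1) fun i => f i - levelWeight m n (p - 1) * labelVec n l i := by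
  have : Fact (1 < m) := ⟨by omega⟩
  obtain ⟨a, g⟩ := v
  rw [bouwer, SimpleGraph.fromRel_adj, bouwerRel_iff, bouwerRel_iff]
  simp only [vtx, levelWeight, Prod.mk.injEq, Int.cast_add, Int.cast_sub, Int.cast_one]
  constructor
  · rintro ⟨-, ⟨l, h⟩ | ⟨l, h, rfl⟩⟩
    · exact Or.inl ⟨l, h⟩
    · exact Or.inr ⟨l, by rw [h]; ring, by ext i; simp [h]⟩
  · rintro (⟨l, rfl, rfl⟩ | ⟨l, rfl, rfl⟩)
    · exact ⟨by simp, Or.inl ⟨l, rfl, rfl⟩⟩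
    · exact ⟨by simp [sub_eq_add_neg], Or.inr ⟨l, by ring, by ext i; simp⟩⟩

lemma vtx_eq_imp {p q : ℤ} {f g : Fin (k - 1) → ZMod n}
    (h : vtx m p f = vtx m q g) (hpq : |p - q| < m) : p = q ∧ ∀ i, f i = g i := by
  simp only [vtx, Prod.mk.injEq] at h
  refine ⟨?_, fun i => congrFun h.2 i⟩
  have : ((p - q : ℤ) : ZMod m) = 0 := by simp [h.1]
  linarith [int_eq_zero_of_cast this hpq]

lemma vtx_ext {p q : ℤ} {f g : Fin (k - 1) → ZMod n} (hpq : p = q) (hfg : ∀ i, f i = g i) :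
    vtx m p f = vtx m q g := by
  rw [hpq, funext hfg]

@[simp] lemma labelVec_none (i : Fin (k - 1)) : labelVec n none i = 0 := by simp [labelVec]

lemma tails_of_up_up (hm : 6 < m) (hn : 7 < n) (h2 : (2 : ZMod n) ^ m = 1)
    {s : Option (Fin (k - 1))} {t}
    (ht : t ∈ sixCycleTails (bouwer k m n) (vtx m 0 fun _ => 0) (vtx m 1 fun _ => 0)
      (vtx m 2 fun i => 2 * labelVec n s i)) :
    ∃ r, s = some r ∧ t = (vtx m 1 fun i => 2 * labelVec n (some r) i,
      vtx m 0 (labelVec n (some r)), vtx m 1 (labelVec n (some r))) := by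
  have w0 := levelWeight_zero (n := n) hm
  have w1 : levelWeight m n 1 = 2 := by simpa [w0] using levelWeight_add_one hm h2 0
  have w2 : levelWeight m n 2 = 4 := by
    rw [show (2 : ℤ) = 1 + 1 by rfl, levelWeight_add_one hm h2 1, w1]; norm_num
  have w3 : 1 = 2 * levelWeight m n (-1) := by simpa [w0] using levelWeight_add_one hm h2 (-1)
  obtain ⟨x, y, z⟩ := t
  obtain ⟨h₃, h₄, h₅, h₆, hnd⟩ := ht
  simp only [List.nodup_cons, List.mem_cons, not_or, List.not_mem_nil, not_false_eq_true,
    List.nodup_nil, and_true] at hnd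
  obtain ⟨⟨-, -, -, n04, -⟩, ⟨-, n13, -, n15⟩, ⟨-, n24, -⟩, ⟨-, n35⟩, -⟩ := hnd
  simp only at h₃ h₄ h₅ h₆
  rw [bouwer_adj_vtx_iff hm] at h₃
  rcases h₃ with ⟨a, rfl⟩ | ⟨a, rfl⟩ <;> rw [bouwer_adj_vtx_iff hm] at h₄ <;>
  rcases h₄ with ⟨b, rfl⟩ | ⟨b, rfl⟩ <;> rw [bouwer_adj_vtx_iff hm] at h₅ <;>
  rcases h₅ with ⟨c, rfl⟩ | ⟨c, rfl⟩ <;> rw [bouwer_adj_vtx_iff hm] at h₆ <;>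
  rcases h₆ with ⟨d, h⟩ | ⟨d, h⟩ <;>
  obtain ⟨hq, e⟩ := vtx_eq_imp h (by norm_num; omega)
  any_goals omega
  all_goals
    clear h hq
    simp only [Int.reduceAdd, Int.reduceSub, Int.reduceNeg, w0, w1, w2] at *
    have la := label_nonneg a
    have la' := label_le_one a
    have lb := label_nonneg b
    have lb' := label_le_one b
    have lc := label_nonneg c
    have lc' := label_le_one c
    have ld := label_nonneg d
    have ld' := label_le_one d
    have ls := label_nonneg s
    have ls' := label_le_one s
  · have hd : none ≠ d := by
      rintro rfl
      exact n15 (vtx_ext rfl fun i => by linear_combination e i - labelVec_none (n := n) i)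
    obtain ⟨i, hi⟩ := exists_label_ne hd
    rw [label_none] at hi
    exfalso
    have E : ∀ i, 2 * label s i + 4 * label a i - 4 * label b i - 2 * label c i - label d i = 0 :=
      fun i => int_eq_zero_of_cast (N := n) (by
        have e := e i
        simp only [labelVec] at e
        push_cast
        linear_combination -e) (by
        rw [abs_lt]
        specialize la i; specialize la' i; specialize lb i; specialize lb' i
        specialize lc i; specialize lc' i; specialize ld i; specialize ld' i
        specialize ls i; specialize ls' i
        omega)
    specialize E i
    specialize la i; specialize la' i; specialize lb i; specialize lb' i
    specialize lc i; specialize lc' i; specialize ld i; specialize ld' i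
    specialize ls i; specialize ls' i
    omega
  · have hd : none ≠ d := by
      rintro rfl
      exact n15 (vtx_ext rfl fun i => by linear_combination e i - labelVec_none (n := n) i)
    obtain ⟨i, hi⟩ := exists_label_ne hd
    rw [label_none] at hi
    exfalso
    have E : ∀ i, 2 * label s i - 2 * label a i + 2 * label b i - 2 * label c i - label d i = 0 :=
      fun i => int_eq_zero_of_cast (N := n) (by
        have e := e i
        simp only [labelVec] at e
        push_cast
        linear_combination -e) (by
        rw [abs_lt]
        specialize la i; specialize la' i; specialize lb i; specialize lb' i
        specialize lc i; specialize lc' i; specialize ld i; specialize ld' i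
        specialize ls i; specialize ls' i
        omega)
    specialize E i
    specialize la i; specialize la' i; specialize lb i; specialize lb' i
    specialize lc i; specialize lc' i; specialize ld i; specialize ld' i
    specialize ls i; specialize ls' i
    omega
  · have ha : a ≠ s := by
      rintro rfl
      exact n13 (vtx_ext rfl fun i => by ring)
    have E : ∀ i, 2 * label s i - 2 * label a i - label b i + label c i - label d i = 0 :=
      fun i => int_eq_zero_of_cast (N := n) (by
        have e := e i
        simp only [labelVec] at e
        push_cast
        linear_combination -e) (by
        rw [abs_lt]
        specialize la i; specialize la' i; specialize lb i; specialize lb' i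
        specialize lc i; specialize lc' i; specialize ld i; specialize ld' i
        specialize ls i; specialize ls' i
        omega)
    obtain ⟨i, hi⟩ := exists_label_ne ha
    have H : label s i = 1 ∧ label b i = 1 ∧ label d i = 1 := by
      specialize E i
      specialize la i; specialize la' i; specialize lb i; specialize lb' i
      specialize lc i; specialize lc' i; specialize ld i; specialize ld' i
      specialize ls i; specialize ls' i
      omega
    obtain rfl := eq_some_of_label H.1
    obtain rfl := eq_some_of_label H.2.1
    obtain rfl := eq_some_of_label H.2.2
    obtain rfl : a = none := eq_none_of_label fun i => by
      specialize E i; specialize lc i; specialize lc' i; specialize la i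
      omega
    obtain rfl : c = none := eq_none_of_label fun i => by
      have := label_none i
      specialize E i
      omega
    refine ⟨i, rfl, ?_⟩
    simp only [Prod.mk.injEq]
    exact ⟨vtx_ext rfl fun i => by simp, vtx_ext rfl fun i => by simp; ring,
      vtx_ext rfl fun i => by simp; ring⟩
  · have hcd : c ≠ d := by
      rintro rfl
      exact n04 (vtx_ext rfl fun i => by linear_combination e i)
    obtain ⟨i, hi⟩ := exists_label_ne hcd
    exfalso
    have E : ∀ i, 4 * label s i - 4 * label a i - 2 * label b i - label c i + label d i = 0 :=
      fun i => int_eq_zero_of_cast (N := n) (by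
        have e := e i
        simp only [labelVec] at e
        push_cast
        linear_combination -2 * e + (label d i - label c i) * w3) (by
        rw [abs_lt]
        specialize la i; specialize la' i; specialize lb i; specialize lb' i
        specialize lc i; specialize lc' i; specialize ld i; specialize ld' i
        specialize ls i; specialize ls' i
        omega)
    specialize E i
    specialize la i; specialize la' i; specialize lb i; specialize lb' i
    specialize lc i; specialize lc' i; specialize ld i; specialize ld' i
    specialize ls i; specialize ls' i
    omega

/-- The last three vertices of the 6-cycles through the 2-arc `(0,0) – (1,0) – (0,-e_r)`. -/
def downTail (m n : ℕ) (r : Fin (k - 1)) :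
    Option (Fin (k - 1)) → (ZMod m × (Fin (k - 1) → ZMod n)) ×
      (ZMod m × (Fin (k - 1) → ZMod n)) × (ZMod m × (Fin (k - 1) → ZMod n))
  | none => (vtx m 1 fun i => -labelVec n (some r) i, vtx m 2 (labelVec n (some r)),
      vtx m 1 (labelVec n (some r)))
  | some q =>
    if q = r then
      (vtx m (-1) fun i => -labelVec n (some r) i,
        vtx m 0 fun i => -(levelWeight m n (-1) * labelVec n (some r) i),
        vtx m (-1) fun i => -(levelWeight m n (-1) * labelVec n (some r) i))
    else
      (vtx m 1 fun i => labelVec n (some q) i - labelVec n (some r) i,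
        vtx m 0 fun i => labelVec n (some q) i - labelVec n (some r) i,
        vtx m 1 (labelVec n (some q)))

lemma tails_of_up_down (hm : 6 < m) (hn : 7 < n) (h2 : (2 : ZMod n) ^ m = 1)
    {r : Fin (k - 1)} {t}
    (ht : t ∈ sixCycleTails (bouwer k m n) (vtx m 0 fun _ => 0) (vtx m 1 fun _ => 0)
      (vtx m 0 fun i => -labelVec n (some r) i)) :
    ∃ l, t = downTail m n r l := by
  have w0 := levelWeight_zero (n := n) hm
  have w1 : levelWeight m n 1 = 2 := by simpa [w0] using levelWeight_add_one hm h2 0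
  have w2 : levelWeight m n 2 = 4 := by
    rw [show (2 : ℤ) = 1 + 1 by rfl, levelWeight_add_one hm h2 1, w1]; norm_num
  have w3 : 1 = 2 * levelWeight m n (-1) := by simpa [w0] using levelWeight_add_one hm h2 (-1)
  have w4 : levelWeight m n (-1) = 2 * levelWeight m n (-2) := by
    simpa using levelWeight_add_one (n := n) hm h2 (-2)
  obtain ⟨x, y, z⟩ := t
  obtain ⟨h₃, h₄, h₅, h₆, hnd⟩ := ht
  simp only [List.nodup_cons, List.mem_cons, not_or, List.not_mem_nil, not_false_eq_true,
    List.nodup_nil, and_true] at hnd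
  obtain ⟨⟨-, -, -, n04, -⟩, ⟨-, n13, -, n15⟩, ⟨-, n24, -⟩, ⟨-, n35⟩, -⟩ := hnd
  simp only at h₃ h₄ h₅ h₆
  rw [bouwer_adj_vtx_iff hm] at h₃
  rcases h₃ with ⟨a, rfl⟩ | ⟨a, rfl⟩ <;> rw [bouwer_adj_vtx_iff hm] at h₄ <;>
  rcases h₄ with ⟨b, rfl⟩ | ⟨b, rfl⟩ <;> rw [bouwer_adj_vtx_iff hm] at h₅ <;>
  rcases h₅ with ⟨c, rfl⟩ | ⟨c, rfl⟩ <;> rw [bouwer_adj_vtx_iff hm] at h₆ <;>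
  rcases h₆ with ⟨d, h⟩ | ⟨d, h⟩ <;>
  obtain ⟨hq, e⟩ := vtx_eq_imp h (by norm_num; omega)
  any_goals omega
  all_goals
    clear h hq
    simp only [Int.reduceAdd, Int.reduceSub, Int.reduceNeg, zero_add, zero_sub, w0, w1, w2] at *
    have la := label_nonneg a
    have la' := label_le_one a
    have lb := label_nonneg b
    have lb' := label_le_one b
    have lc := label_nonneg c
    have lc' := label_le_one c
    have ld := label_nonneg d
    have ld' := label_le_one d
    have ls := label_nonneg (some r)
    have ls' := label_le_one (some r)
  · have ha : a ≠ some r := by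
      rintro rfl
      exact n13 (vtx_ext rfl fun i => by ring)
    have har : label a r ≠ 1 := fun h => ha (eq_some_of_label h)
    have E : ∀ i, -label (some r) i + label a i + 2 * label b i - 2 * label c i - label d i = 0 :=
      fun i => int_eq_zero_of_cast (N := n) (by
        have e := e i
        simp only [labelVec] at e
        push_cast
        linear_combination -e) (by
        rw [abs_lt]
        specialize la i; specialize la' i; specialize lb i; specialize lb' i
        specialize lc i; specialize lc' i; specialize ld i; specialize ld' i
        specialize ls i; specialize ls' i
        omega)
    have H : label b r = 1 ∧ label d r = 1 := by
      have := label_some_self r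
      specialize E r; specialize la r; specialize la' r; specialize lb r
      specialize lb' r; specialize lc r; specialize lc' r; specialize ld r
      specialize ld' r
      omega
    obtain rfl := eq_some_of_label H.1
    obtain rfl := eq_some_of_label H.2
    obtain rfl : c = none := eq_none_of_label fun i => by
      specialize E i; specialize la i; specialize la' i; specialize lc i
      omega
    obtain rfl : a = none := eq_none_of_label fun i => by
      have := label_none i
      specialize E i
      omega
    refine ⟨none, ?_⟩
    simp only [Prod.mk.injEq, downTail]
    exact ⟨vtx_ext rfl fun i => by simp, vtx_ext rfl fun i => by simp; ring,
      vtx_ext rfl fun i => by simp; ring⟩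
  · have ha : a ≠ some r := by
      rintro rfl
      exact n13 (vtx_ext rfl fun i => by ring)
    have har : label a r ≠ 1 := fun h => ha (eq_some_of_label h)
    have E : ∀ i, -label (some r) i + label a i - label b i + label c i - label d i = 0 :=
      fun i => int_eq_zero_of_cast (N := n) (by
        have e := e i
        simp only [labelVec] at e
        push_cast
        linear_combination -e) (by
        rw [abs_lt]
        specialize la i; specialize la' i; specialize lb i; specialize lb' i
        specialize lc i; specialize lc' i; specialize ld i; specialize ld' i
        specialize ls i; specialize ls' i
        omega)
    have hd : none ≠ d := by
      rintro rfl
      exact n15 (vtx_ext rfl fun i => by linear_combination e i - labelVec_none (n := n) i)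
    have H : label c r = 1 := by
      have := label_some_self r
      specialize E r; specialize la r; specialize la' r; specialize lb r
      specialize lb' r; specialize lc r; specialize lc' r; specialize ld r
      specialize ld' r
      omega
    obtain rfl := eq_some_of_label H
    obtain ⟨j, hj⟩ := exists_label_ne hd
    rw [label_none] at hj
    have H : label a j = 1 ∧ label d j = 1 := by
      specialize E j; specialize la j; specialize la' j; specialize lb j
      specialize lb' j; specialize lc j; specialize lc' j; specialize ld j
      specialize ld' j
      omega
    obtain rfl := eq_some_of_label H.1
    obtain rfl := eq_some_of_label H.2
    obtain rfl : b = none := eq_none_of_label fun i => by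
      specialize E i
      omega
    have hjr : j ≠ r := fun h => ha (by rw [h])
    refine ⟨some j, ?_⟩
    simp only [Prod.mk.injEq, downTail, if_neg hjr]
    exact ⟨vtx_ext rfl fun i => by ring, vtx_ext rfl fun i => by simp; ring,
      vtx_ext rfl fun i => by simp⟩
  · have hcd : c ≠ d := by
      rintro rfl
      exact n04 (vtx_ext rfl fun i => by linear_combination e i)
    obtain ⟨i, hi⟩ := exists_label_ne hcd
    exfalso
    have E : ∀ i, -2 * label (some r) i + 2 * label a i - 2 * label b i - label c i + label d i = 0 :=
      fun i => int_eq_zero_of_cast (N := n) (by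
        have e := e i
        simp only [labelVec] at e
        push_cast
        linear_combination -2 * e + (label d i - label c i) * w3) (by
        rw [abs_lt]
        specialize la i; specialize la' i; specialize lb i; specialize lb' i
        specialize lc i; specialize lc' i; specialize ld i; specialize ld' i
        specialize ls i; specialize ls' i
        omega)
    specialize E i
    specialize la i; specialize la' i; specialize lb i; specialize lb' i
    specialize lc i; specialize lc' i; specialize ld i; specialize ld' i
    specialize ls i; specialize ls' i
    omega
  · have hab : a ≠ b := by
      rintro rfl
      exact n24 (vtx_ext rfl fun i => by ring)
    obtain ⟨i, hi⟩ := exists_label_ne hab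
    exfalso
    have E : ∀ i, -2 * label (some r) i - label a i + label b i + 2 * label c i - 2 * label d i = 0 :=
      fun i => int_eq_zero_of_cast (N := n) (by
        have e := e i
        simp only [labelVec] at e
        push_cast
        linear_combination -2 * e + (label b i - label a i) * w3) (by
        rw [abs_lt]
        specialize la i; specialize la' i; specialize lb i; specialize lb' i
        specialize lc i; specialize lc' i; specialize ld i; specialize ld' i
        specialize ls i; specialize ls' i
        omega)
    specialize E i
    specialize la i; specialize la' i; specialize lb i; specialize lb' i
    specialize lc i; specialize lc' i; specialize ld i; specialize ld' i
    specialize ls i; specialize ls' i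
    omega
  · have E : ∀ i, -2 * label (some r) i - label a i + label b i - label c i + label d i = 0 :=
      fun i => int_eq_zero_of_cast (N := n) (by
        have e := e i
        simp only [labelVec] at e
        push_cast
        linear_combination -2 * e + (label b i - label a i + label d i - label c i) * w3) (by
        rw [abs_lt]
        specialize la i; specialize la' i; specialize lb i; specialize lb' i
        specialize lc i; specialize lc' i; specialize ld i; specialize ld' i
        specialize ls i; specialize ls' i
        omega)
    have H : label b r = 1 ∧ label d r = 1 := by
      have := label_some_self r
      specialize E r; specialize la r; specialize la' r; specialize lb r
      specialize lb' r; specialize lc r; specialize lc' r; specialize ld r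
      specialize ld' r
      omega
    obtain rfl := eq_some_of_label H.1
    obtain rfl := eq_some_of_label H.2
    obtain rfl : a = none := eq_none_of_label fun i => by
      specialize E i; specialize la i; specialize lc i
      omega
    obtain rfl : c = none := eq_none_of_label fun i => by
      have := label_none i
      specialize E i
      omega
    refine ⟨some r, ?_⟩
    simp only [Prod.mk.injEq, downTail, if_true]
    exact ⟨vtx_ext rfl fun i => by simp,
      vtx_ext rfl fun i => by simp; linear_combination (-labelVec n (some r) i) * w3,
      vtx_ext rfl fun i => by simp; linear_combination (-labelVec n (some r) i) * w3⟩
  · have hbc : b ≠ c := by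
      rintro rfl
      exact n35 (vtx_ext rfl fun i => by ring)
    obtain ⟨i, hi⟩ := exists_label_ne hbc
    exfalso
    have E : ∀ i, -4 * label (some r) i - 2 * label a i - label b i + label c i + 2 * label d i = 0 :=
      fun i => int_eq_zero_of_cast (N := n) (by
        have e := e i
        simp only [labelVec] at e
        push_cast
        linear_combination -4 * e + (label c i - label b i) * (w3 + 2 * w4) + 2 * (label d i - label a i) * w3) (by
        rw [abs_lt]
        specialize la i; specialize la' i; specialize lb i; specialize lb' i
        specialize lc i; specialize lc' i; specialize ld i; specialize ld' i
        specialize ls i; specialize ls' i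
        omega)
    specialize E i
    specialize la i; specialize la' i; specialize lb i; specialize lb' i
    specialize lc i; specialize lc' i; specialize ld i; specialize ld' i
    specialize ls i; specialize ls' i
    omega

@[simp] lemma labelVec_self (i : Fin (k - 1)) : labelVec n (some i) i = 1 := by simp [labelVec]

lemma labelVec_of_ne {i j : Fin (k - 1)} (h : i ≠ j) : labelVec n (some i) j = 0 := by
  simp [labelVec, label, h]

lemma one_ne_zero_and_two_ne_zero (hn : 7 < n) : (1 : ZMod n) ≠ 0 ∧ (2 : ZMod n) ≠ 0 := by
  constructor
  · intro h
    have := int_eq_zero_of_cast (N := n) (z := 1) (by simpa using h) (by norm_num; omega)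
    omega
  · intro h
    have := int_eq_zero_of_cast (N := n) (z := 2) (by simpa using h) (by norm_num; omega)
    omega

lemma bouwer_adj_up (hm : 6 < m) {p q : ℤ} {f g : Fin (k - 1) → ZMod n}
    (l : Option (Fin (k - 1))) (hq : q = p + 1)
    (hg : ∀ i, g i = f i + levelWeight m n p * labelVec n l i) :
    (bouwer k m n).Adj (vtx m p f) (vtx m q g) :=
  (bouwer_adj_vtx_iff hm p f _).mpr (Or.inl ⟨l, vtx_ext hq hg⟩)

lemma mem_tails_of_up_up (hm : 6 < m) (hn : 7 < n) (h2 : (2 : ZMod n) ^ m = 1)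
    (r : Fin (k - 1)) :
    (vtx m 1 fun i => 2 * labelVec n (some r) i, vtx m 0 (labelVec n (some r)),
      vtx m 1 (labelVec n (some r))) ∈
    sixCycleTails (bouwer k m n) (vtx m 0 fun _ => 0) (vtx m 1 fun _ => 0)
      (vtx m 2 fun i => 2 * labelVec n (some r) i) := by
  have w0 := levelWeight_zero (n := n) hm
  have w1 : levelWeight m n 1 = 2 := by simpa [w0] using levelWeight_add_one hm h2 0
  obtain ⟨o1, o2⟩ := one_ne_zero_and_two_ne_zero hn
  refine ⟨(bouwer_adj_up hm none (by norm_num) fun i => by simp).symm,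
    (bouwer_adj_up hm (some r) (by norm_num) fun i => by rw [w0]; ring).symm,
    bouwer_adj_up hm none (by norm_num) fun i => by simp,
    (bouwer_adj_up hm (some r) (by norm_num) fun i => by simp [w0]).symm, ?_⟩
  simp only [List.nodup_cons, List.mem_cons, not_or, List.not_mem_nil, not_false_eq_true,
    List.nodup_nil, and_true]
  refine ⟨⟨?_, ?_, ?_, ?_, ?_⟩, ⟨?_, ?_, ?_, ?_⟩, ⟨?_, ?_, ?_⟩, ⟨?_, ?_⟩, ?_⟩
  all_goals
    intro h
    obtain ⟨hp, hf⟩ := vtx_eq_imp h (by norm_num; try omega)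
    have hr := hf r
    simp only [labelVec_self] at hr
    first | grind | exact o1 (by linear_combination hr)

lemma downTail_mem_tails (hm : 6 < m) (hn : 7 < n) (h2 : (2 : ZMod n) ^ m = 1)
    (r : Fin (k - 1)) (l : Option (Fin (k - 1))) :
    downTail m n r l ∈
    sixCycleTails (bouwer k m n) (vtx m 0 fun _ => 0) (vtx m 1 fun _ => 0)
      (vtx m 0 fun i => -labelVec n (some r) i) := by
  have w0 := levelWeight_zero (n := n) hm
  have w1 : levelWeight m n 1 = 2 := by simpa [w0] using levelWeight_add_one hm h2 0
  have w3 : 1 = 2 * levelWeight m n (-1) := by simpa [w0] using levelWeight_add_one hm h2 (-1)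
  obtain ⟨o1, o2⟩ := one_ne_zero_and_two_ne_zero hn
  rcases l with - | q
  · simp only [downTail]
    refine ⟨bouwer_adj_up hm none (by norm_num) fun i => by simp,
      bouwer_adj_up hm (some r) (by norm_num) fun i => by rw [w1]; ring,
      (bouwer_adj_up hm none (by norm_num) fun i => by simp).symm,
      (bouwer_adj_up hm (some r) (by norm_num) fun i => by simp [w0]).symm, ?_⟩
    simp only [List.nodup_cons, List.mem_cons, not_or, List.not_mem_nil, not_false_eq_true,
      List.nodup_nil, and_true]
    refine ⟨⟨?_, ?_, ?_, ?_, ?_⟩, ⟨?_, ?_, ?_, ?_⟩, ⟨?_, ?_, ?_⟩, ⟨?_, ?_⟩, ?_⟩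
    all_goals
      intro h
      obtain ⟨hp, hf⟩ := vtx_eq_imp h (by norm_num; try omega)
      have hr := hf r
      simp only [labelVec_self] at hr
      grind
  by_cases hq : q = r
  · simp only [downTail, if_pos hq]
    refine ⟨(bouwer_adj_up hm none (by norm_num) fun i => by simp).symm,
      bouwer_adj_up hm (some r) (by norm_num) fun i => by
        linear_combination (labelVec n (some r) i) * w3,
      (bouwer_adj_up hm none (by norm_num) fun i => by simp).symm,
      bouwer_adj_up hm (some r) (by norm_num) fun i => by simp, ?_⟩
    simp only [List.nodup_cons, List.mem_cons, not_or, List.not_mem_nil, not_false_eq_true,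
      List.nodup_nil, and_true]
    refine ⟨⟨?_, ?_, ?_, ?_, ?_⟩, ⟨?_, ?_, ?_, ?_⟩, ⟨?_, ?_, ?_⟩, ⟨?_, ?_⟩, ?_⟩
    all_goals
      intro h
      obtain ⟨hp, hf⟩ := vtx_eq_imp h (by norm_num; try omega)
      have hr := hf r
      simp only [labelVec_self] at hr
      grind
  · simp only [downTail, if_neg hq]
    refine ⟨bouwer_adj_up hm (some q) (by norm_num) fun i => by rw [w0]; ring,
      (bouwer_adj_up hm none (by norm_num) fun i => by simp).symm,
      bouwer_adj_up hm (some r) (by norm_num) fun i => by simp [w0],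
      (bouwer_adj_up hm (some q) (by norm_num) fun i => by simp [w0]).symm, ?_⟩
    simp only [List.nodup_cons, List.mem_cons, not_or, List.not_mem_nil, not_false_eq_true,
      List.nodup_nil, and_true]
    refine ⟨⟨?_, ?_, ?_, ?_, ?_⟩, ⟨?_, ?_, ?_, ?_⟩, ⟨?_, ?_, ?_⟩, ⟨?_, ?_⟩, ?_⟩
    all_goals
      intro h
      obtain ⟨hp, hf⟩ := vtx_eq_imp h (by norm_num; try omega)
      have hr := hf r
      have hr' := hf q
      simp only [labelVec_self, labelVec_of_ne hq, labelVec_of_ne (Ne.symm hq)] at hr hr'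
      grind

lemma downTail_injective (hm : 6 < m) (hn : 7 < n) (r : Fin (k - 1)) :
    Function.Injective (downTail m n r) := by
  obtain ⟨o1, o2⟩ := one_ne_zero_and_two_ne_zero hn
  have key : ∀ (p q : ℤ) (f g : Fin (k - 1) → ZMod n), |p - q| ≤ 6 → vtx m p f = vtx m q g →
      p = q ∧ ∀ i, f i = g i := fun p q f g h h' => vtx_eq_imp h' (by omega)
  rintro (- | a) (- | b) h
  · rfl
  · simp only [downTail] at h
    split_ifs at h <;> have := (key _ _ _ _ (by norm_num) (congrArg (fun t => t.2.1) h)).1 <;> omega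
  · simp only [downTail] at h
    split_ifs at h <;> have := (key _ _ _ _ (by norm_num) (congrArg (fun t => t.2.1) h)).1 <;> omega
  · simp only [downTail] at h
    split_ifs at h with ha hb hb
    · rw [ha, hb]
    · have := (key _ _ _ _ (by norm_num) (congrArg (fun t => t.1) h)).1
      omega
    · have := (key _ _ _ _ (by norm_num) (congrArg (fun t => t.1) h)).1
      omega
    · have := (key _ _ _ _ (by norm_num) (congrArg (fun t => t.2.2) h)).2 a
      by_contra hab
      have hab : b ≠ a := fun h => hab (by rw [h])
      rw [labelVec_self, labelVec_of_ne hab] at this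
      exact o1 this

end Bouwer

/-- Assume `m > 6` and `n > 7`. In `B(k,m,n)`, the 2-arc `(0,0) – (1,0) – (2,0)`
lies in no 6-cycle; each 2-arc of the form `(0,0) – (1,0) – (2, 2e_r)` lies in
exactly one 6-cycle; and each 2-arc of the form `(0,0) – (1,0) – (0, -e_r)` lies
in exactly `k` different 6-cycles. -/
theorem bouwer_count_sixcycles (k m n : ℕ) (hk : 1 < k) (hm : 6 < m) (hn : 7 < n)
    (h2 : (2 : ZMod n) ^ m = 1) :
    numSixCyclesThru (bouwer k m n) ((0 : ZMod m), (0 : Fin (k - 1) → ZMod n))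
      (1, 0) (2, 0) = 0 ∧
    (∀ r : Fin (k - 1),
      numSixCyclesThru (bouwer k m n) (0, 0) (1, 0)
        (2, fun i => 2 * stdBasis k n r i) = 1) ∧
    (∀ r : Fin (k - 1),
      numSixCyclesThru (bouwer k m n) (0, 0) (1, 0)
        (0, fun i => -(stdBasis k n r i)) = k) := by
  have v0 : ((0 : ZMod m), (0 : Fin (k - 1) → ZMod n)) = vtx m 0 fun _ => 0 := by
    ext <;> simp [vtx]
  have v1 : ((1 : ZMod m), (0 : Fin (k - 1) → ZMod n)) = vtx m 1 fun _ => 0 := by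
    ext <;> simp [vtx]
  have v2 : ((2 : ZMod m), (0 : Fin (k - 1) → ZMod n)) =
      vtx m 2 fun i => 2 * labelVec n none i := by
    ext <;> simp [vtx]
  have v2' : ∀ r : Fin (k - 1), ((2 : ZMod m), fun i => 2 * stdBasis k n r i) =
      vtx m 2 fun i => 2 * labelVec n (some r) i := fun r => by
    ext <;> simp [vtx, stdBasis, labelVec, label, eq_comm]
  have v2'' : ∀ r : Fin (k - 1), ((0 : ZMod m), fun i => -stdBasis k n r i) =
      vtx m 0 fun i => -labelVec n (some r) i := fun r => by
    ext <;> simp [vtx, stdBasis, labelVec, label, eq_comm]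
  have w0 := levelWeight_zero (n := n) hm
  have w1 : levelWeight m n 1 = 2 := by simpa [w0] using levelWeight_add_one hm h2 0
  have h01 : (bouwer k m n).Adj (vtx m 0 fun _ => 0) (vtx m 1 fun _ => 0) :=
    bouwer_adj_up hm none rfl fun i => by simp
  have h12 : ∀ s, (bouwer k m n).Adj (vtx m 1 fun _ => 0)
      (vtx m 2 fun i => 2 * labelVec n s i) := fun s =>
    bouwer_adj_up hm s rfl fun i => by rw [w1, zero_add]
  have h10 : ∀ s, (bouwer k m n).Adj (vtx m 1 fun _ => 0)
      (vtx m 0 fun i => -labelVec n s i) := fun s =>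
    (bouwer_adj_up hm s (by norm_num) fun i => by simp [w0]).symm
  refine ⟨?_, fun r => ?_, fun r => ?_⟩
  · rw [v0, v1, v2, numSixCyclesThru_eq_ncard_tails h01 (h12 none)]
    suffices H : sixCycleTails (bouwer k m n) (vtx m 0 fun _ => 0) (vtx m 1 fun _ => 0)
        (vtx m 2 fun i => 2 * labelVec n none i) = ∅ by rw [H, Set.ncard_empty]
    refine Set.eq_empty_iff_forall_notMem.mpr fun t ht => ?_
    obtain ⟨r, hr, -⟩ := tails_of_up_up hm hn h2 ht
    cases hr
  · rw [v2' r]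
    erw [v0, v1]
    rw [numSixCyclesThru_eq_ncard_tails h01 (h12 (some r)), Set.ncard_eq_one]
    refine ⟨_, Set.eq_singleton_iff_unique_mem.mpr ⟨mem_tails_of_up_up hm hn h2 r, fun t ht => ?_⟩⟩
    obtain ⟨r', hr, h⟩ := tails_of_up_up hm hn h2 ht
    cases hr
    exact h
  · rw [v2'' r]
    erw [v0, v1]
    rw [numSixCyclesThru_eq_ncard_tails h01 (h10 (some r))]
    have : sixCycleTails (bouwer k m n) (vtx m 0 fun _ => 0) (vtx m 1 fun _ => 0)
        (vtx m 0 fun i => -labelVec n (some r) i) = downTail m n r '' Set.univ := by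
      ext t
      constructor
      · intro ht
        obtain ⟨l, rfl⟩ := tails_of_up_down hm hn h2 ht
        exact ⟨l, trivial, rfl⟩
      · rintro ⟨l, -, rfl⟩
        exact downTail_mem_tails hm hn h2 r l
    rw [this, Set.ncard_image_of_injective _ (downTail_injective hm hn r), Set.ncard_univ,
      Nat.card_eq_fintype_card, Fintype.card_option, Fintype.card_fin]
    omega
end
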